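/- Let u(x,y,t) = x − 3yt − 2x³, u⁺ = max(u,0), u⁻ = max(−u,0), and define J(r) = r^{-4} · (∫_{B^{ℍ¹}_r(0)} |∇_{ℍ¹}u⁺|²/|ξ|²_{ℍ¹} dξ) · (∫_{B^{ℍ¹}_r(0)} |∇_{ℍ¹}u⁻|²/|ξ|²_{ℍ¹} dξ). Then J is strictly monotone decreasing on a right neighborhood of r = 0. -/

import Mathlib

open MeasureTheory

/-- The Koranyi gauge on ℍ¹ = ℝ³. -/
noncomputable def koranyi (ξ : ℝ × ℝ × ℝ) : ℝ :=
  ((ξ.1 ^ 2 + ξ.2.1 ^ 2) ^ 2 + ξ.2.2 ^ 2) ^ ((1 : ℝ) / 4)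

/-- The Koranyi ball of radius r centered at 0. -/
def koranyiBall (r : ℝ) : Set (ℝ × ℝ × ℝ) := {ξ | koranyi ξ < r}

/-- u = x − 3yt − 2x³. -/
def uFun (ξ : ℝ × ℝ × ℝ) : ℝ := ξ.1 - 3 * ξ.2.1 * ξ.2.2 - 2 * ξ.1 ^ 3

/-- |∇_{ℍ¹}u|² = (1−6(x²+y²))² + 9(−t+2xy)² for u = x − 3yt − 2x³. -/
def gradSq (ξ : ℝ × ℝ × ℝ) : ℝ :=
  (1 - 6 * (ξ.1 ^ 2 + ξ.2.1 ^ 2)) ^ 2 + 9 * (-ξ.2.2 + 2 * ξ.1 * ξ.2.1) ^ 2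

/-- The Alt–Caffarelli–Friedman type functional
    J(r) = r⁻⁴ (∫_{B_r} |∇_{ℍ¹}u⁺|²/|ξ|² dξ)(∫_{B_r} |∇_{ℍ¹}u⁻|²/|ξ|² dξ),
    using that |∇_{ℍ¹}u⁺|² = |∇_{ℍ¹}u|²·1_{{u>0}} a.e. and likewise for u⁻. -/
noncomputable def Jfun (r : ℝ) : ℝ :=
  (1 / r ^ 4) *
    (∫ ξ in koranyiBall r ∩ {ξ | 0 < uFun ξ}, gradSq ξ / (koranyi ξ) ^ 2) *
    (∫ ξ in koranyiBall r ∩ {ξ | uFun ξ < 0}, gradSq ξ / (koranyi ξ) ^ 2)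

instance haar2 : (volume : Measure (ℝ × ℝ)).IsAddHaarMeasure :=
  Measure.prod.instIsAddHaarMeasure (volume : Measure ℝ) (volume : Measure ℝ)

instance haar3 : (volume : Measure (ℝ × ℝ × ℝ)).IsAddHaarMeasure :=
  Measure.prod.instIsAddHaarMeasure (volume : Measure ℝ) (volume : Measure (ℝ × ℝ))


theorem kor_cont : Continuous koranyi := by
  unfold koranyi
  exact Continuous.rpow_const (by fun_prop) (fun _ => Or.inr (by norm_num))

theorem kor_nonneg (ξ : ℝ × ℝ × ℝ) : 0 ≤ koranyi ξ := by
  unfold koranyi; positivity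

theorem kor_pow4 (ξ : ℝ × ℝ × ℝ) :
    koranyi ξ ^ 4 = (ξ.1 ^ 2 + ξ.2.1 ^ 2) ^ 2 + ξ.2.2 ^ 2 := by
  unfold koranyi
  rw [← Real.rpow_natCast, ← Real.rpow_mul (by positivity)]
  norm_num

theorem ball_open (r : ℝ) : IsOpen (koranyiBall r) :=
  isOpen_lt kor_cont continuous_const

theorem lt_one_iff (ξ : ℝ × ℝ × ℝ) : ξ ∈ koranyiBall 1 ↔
    (ξ.1 ^ 2 + ξ.2.1 ^ 2) ^ 2 + ξ.2.2 ^ 2 < 1 := by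
  rw [← kor_pow4]
  exact (pow_lt_one_iff_of_nonneg (kor_nonneg ξ) (by norm_num)).symm

theorem ball_bounds {ξ : ℝ × ℝ × ℝ} (h : ξ ∈ koranyiBall 1) :
    |ξ.1| ≤ 1 ∧ |ξ.2.1| ≤ 1 ∧ |ξ.2.2| ≤ 1 ∧ ξ.1 ^ 2 + ξ.2.1 ^ 2 ≤ 1 := by
  rw [lt_one_iff] at h
  have h0 : ξ.1 ^ 2 + ξ.2.1 ^ 2 ≤ 1 := by
    nlinarith [sq_nonneg ξ.2.2, sq_nonneg ξ.1, sq_nonneg ξ.2.1]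
  refine ⟨?_, ?_, ?_, h0⟩ <;> rw [← sq_le_one_iff_abs_le_one]
  · nlinarith [sq_nonneg ξ.2.1]
  · nlinarith [sq_nonneg ξ.1]
  · nlinarith [sq_nonneg (ξ.1 ^ 2 + ξ.2.1 ^ 2)]

/-- One dimensional weight. -/
noncomputable def wgt (x : ℝ) : ℝ := (Set.Icc (-1 : ℝ) 1).indicator (fun x => |x| ^ (-(1/2) : ℝ)) x

theorem wgt_int : Integrable wgt := by
  have h1 : IntervalIntegrable (fun x : ℝ => |x| ^ (-(1/2) : ℝ)) volume 0 1 := by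
    refine (intervalIntegral.intervalIntegrable_rpow' (r := -(1/2)) (by norm_num)).congr ?_
    intro x hx
    rw [Set.uIoc_of_le (by norm_num)] at hx
    simp only [abs_of_pos hx.1]
  have h2 : IntervalIntegrable (fun x : ℝ => |x| ^ (-(1/2) : ℝ)) volume (-1) 0 := by
    have := ((IntervalIntegrable.iff_comp_neg).1 h1).symm
    simpa using this
  have h3 := h2.trans h1
  rw [intervalIntegrable_iff_integrableOn_Icc_of_le (by norm_num)] at h3
  exact (integrable_indicator_iff measurableSet_Icc).2 h3

theorem wgt3_int : Integrable (fun ξ : ℝ × ℝ × ℝ => wgt ξ.1 * (wgt ξ.2.1 * wgt ξ.2.2)) :=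
  wgt_int.mul_prod (wgt_int.mul_prod wgt_int)

theorem ae_ne : ∀ᵐ ξ : ℝ × ℝ × ℝ, ξ.1 ≠ 0 ∧ ξ.2.1 ≠ 0 ∧ ξ.2.2 ≠ 0 := by
  have h : ∀ᵐ x : ℝ, x ≠ 0 := by simp [ae_iff]
  have h1 : ∀ᵐ ξ : ℝ × ℝ × ℝ, ξ.1 ≠ 0 := Measure.quasiMeasurePreserving_fst.ae h
  have h2 : ∀ᵐ ξ : ℝ × ℝ, ξ.1 ≠ 0 := Measure.quasiMeasurePreserving_fst.ae h
  have h3 : ∀ᵐ ξ : ℝ × ℝ, ξ.2 ≠ 0 := Measure.quasiMeasurePreserving_snd.ae h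
  have h4 : ∀ᵐ ξ : ℝ × ℝ × ℝ, ξ.2.1 ≠ 0 := Measure.quasiMeasurePreserving_snd.ae h2
  have h5 : ∀ᵐ ξ : ℝ × ℝ × ℝ, ξ.2.2 ≠ 0 := Measure.quasiMeasurePreserving_snd.ae h3
  filter_upwards [h1, h4, h5] with ξ a b c using ⟨a, b, c⟩

theorem inv_int : IntegrableOn (fun ξ => 1 / koranyi ξ ^ 2) (koranyiBall 1) := by
  refine Integrable.mono' (wgt3_int.integrableOn (s := koranyiBall 1)) ?_ ?_
  · have := kor_cont.measurable
    exact (by fun_prop : Measurable (fun ξ => 1 / koranyi ξ ^ 2)).aestronglyMeasurable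
  · filter_upwards [ae_restrict_mem (ball_open 1).measurableSet, ae_restrict_of_ae ae_ne]
      with ξ hb hne
    obtain ⟨hx, hy, ht, -⟩ := ball_bounds hb
    obtain ⟨nx, ny, nt⟩ := hne
    have ax := abs_pos.2 nx
    have ay := abs_pos.2 ny
    have at' := abs_pos.2 nt
    rw [wgt, wgt, wgt, Set.indicator_of_mem (Set.mem_Icc.2 (abs_le.1 hx)), Set.indicator_of_mem (Set.mem_Icc.2 (abs_le.1 hy)),
      Set.indicator_of_mem (Set.mem_Icc.2 (abs_le.1 ht)), ← Real.mul_rpow ay.le at'.le,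
      ← Real.mul_rpow ax.le (by positivity), Real.rpow_neg (by positivity), ← Real.sqrt_eq_rpow,
      Real.norm_of_nonneg (by positivity), one_div]
    apply inv_anti₀ (by positivity)
    apply Real.sqrt_le_iff.2 ⟨by positivity, ?_⟩
    rw [← pow_mul, kor_pow4, ← sq_abs ξ.1, ← sq_abs ξ.2.1, ← sq_abs ξ.2.2]
    generalize |ξ.1| = x at *
    generalize |ξ.2.1| = y at *
    generalize |ξ.2.2| = t at *
    nlinarith [sq_nonneg (x^2-y^2), sq_nonneg (2*x*y-t), mul_pos ax (mul_pos ay at')]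

theorem mul_inv_int {g : ℝ × ℝ × ℝ → ℝ} (hg : Continuous g) (C : ℝ)
    (hC : ∀ ξ ∈ koranyiBall 1, |g ξ| ≤ C) :
    IntegrableOn (fun ξ => g ξ / koranyi ξ ^ 2) (koranyiBall 1) := by
  have := Integrable.bdd_mul (c := C) inv_int (f := g) hg.aestronglyMeasurable
    (by filter_upwards [ae_restrict_mem (ball_open 1).measurableSet] with ξ h using hC ξ h)
  refine this.congr (Filter.Eventually.of_forall fun ξ => ?_)
  simp [div_eq_mul_inv]

/-- dilation -/
noncomputable def dil (r : ℝ) : (ℝ × ℝ × ℝ) →L[ℝ] (ℝ × ℝ × ℝ) :=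
  (r • ContinuousLinearMap.id ℝ ℝ).prodMap
    ((r • ContinuousLinearMap.id ℝ ℝ).prodMap (r ^ 2 • ContinuousLinearMap.id ℝ ℝ))

theorem dil_apply (r : ℝ) (ξ : ℝ × ℝ × ℝ) : dil r ξ = (r * ξ.1, r * ξ.2.1, r ^ 2 * ξ.2.2) := by
  rfl

theorem dil_det (r : ℝ) : (dil r).det = r ^ 4 := by
  have : ((dil r : (ℝ × ℝ × ℝ) →L[ℝ] (ℝ × ℝ × ℝ)) : (ℝ × ℝ × ℝ) →ₗ[ℝ] (ℝ × ℝ × ℝ)) =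
    (r • LinearMap.id).prodMap ((r • LinearMap.id).prodMap (r ^ 2 • LinearMap.id)) := by
    ext <;> simp [dil]
  rw [ContinuousLinearMap.det, this, LinearMap.det_prodMap, LinearMap.det_prodMap]
  simp
  ring

theorem kor_dil {r : ℝ} (hr : 0 < r) (ξ : ℝ × ℝ × ℝ) : koranyi (dil r ξ) = r * koranyi ξ := by
  have := kor_nonneg ξ
  refine (pow_left_inj₀ (kor_nonneg _) (by positivity) (n := 4) (by norm_num)).1 ?_
  rw [mul_pow, kor_pow4, kor_pow4, dil_apply]
  ring

theorem dil_dil {r : ℝ} (hr : 0 < r) (ξ : ℝ × ℝ × ℝ) : dil r (dil r⁻¹ ξ) = ξ := by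
  rw [dil_apply, dil_apply]
  ext <;> simp <;> field_simp

theorem dil_image {r : ℝ} (hr : 0 < r) : dil r '' koranyiBall 1 = koranyiBall r := by
  ext ξ
  constructor
  · rintro ⟨η, h, rfl⟩
    change koranyi _ < r
    rw [kor_dil hr]
    have h : koranyi η < 1 := h
    nlinarith
  · intro h
    refine ⟨dil r⁻¹ ξ, ?_, dil_dil hr ξ⟩
    change koranyi _ < 1
    have h : koranyi ξ < r := h
    rw [kor_dil (inv_pos.2 hr), inv_mul_lt_iff₀ hr]
    simpa using h

theorem int_scale {r : ℝ} (hr : 0 < r) :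
    ∫ ξ in koranyiBall r, gradSq ξ / koranyi ξ ^ 2 =
      ∫ ξ in koranyiBall 1, r ^ 2 * (gradSq (dil r ξ) / koranyi ξ ^ 2) := by
  rw [← dil_image hr, integral_image_eq_integral_abs_det_fderiv_smul volume
    (ball_open 1).measurableSet (f' := fun _ => dil r)
    (fun x _ => (dil r).hasFDerivAt.hasFDerivWithinAt)]
  · congr 1
    ext ξ
    rw [dil_det, kor_dil hr, abs_of_pos (by positivity), smul_eq_mul]
    by_cases h : koranyi ξ = 0
    · simp [h]
    · field_simp
  · intro a _ b _ h
    simp only [dil_apply, Prod.mk.injEq, mul_eq_mul_left_iff, hr.ne', pow_ne_zero, or_false,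
      ne_eq, OfNat.ofNat_ne_zero, not_false_eq_true] at h
    ext
    · exact h.1
    · exact h.2.1
    · simpa [hr.ne'] using h.2.2

theorem scaled_int {r : ℝ} : ∫ ξ in koranyiBall 1, gradSq (dil r ξ) / koranyi ξ ^ 2 =
    (∫ ξ in koranyiBall 1, 1 / koranyi ξ ^ 2)
    - r ^ 2 * (∫ ξ in koranyiBall 1, (12 * (ξ.1 ^ 2 + ξ.2.1 ^ 2)) / koranyi ξ ^ 2)
    + r ^ 4 * (∫ ξ in koranyiBall 1, (36 * (ξ.1 ^ 2 + ξ.2.1 ^ 2) ^ 2 +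
        9 * (-ξ.2.2 + 2 * ξ.1 * ξ.2.1) ^ 2) / koranyi ξ ^ 2) := by
  have i2 : IntegrableOn (fun ξ : ℝ × ℝ × ℝ =>
      (12 * (ξ.1 ^ 2 + ξ.2.1 ^ 2)) / koranyi ξ ^ 2) (koranyiBall 1) := by
    refine mul_inv_int (g := fun ξ => 12 * (ξ.1 ^ 2 + ξ.2.1 ^ 2)) (by fun_prop) 12 ?_
    intro ξ h
    have := (ball_bounds h).2.2.2
    rw [abs_of_nonneg (by positivity)]
    linarith
  have i3 : IntegrableOn (fun ξ : ℝ × ℝ × ℝ =>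
      (36 * (ξ.1 ^ 2 + ξ.2.1 ^ 2) ^ 2 +
        9 * (-ξ.2.2 + 2 * ξ.1 * ξ.2.1) ^ 2) / koranyi ξ ^ 2) (koranyiBall 1) := by
    refine mul_inv_int (g := fun ξ => 36 * (ξ.1 ^ 2 + ξ.2.1 ^ 2) ^ 2 +
        9 * (-ξ.2.2 + 2 * ξ.1 * ξ.2.1) ^ 2) (by fun_prop) 1000 ?_
    intro ξ h
    obtain ⟨hx, hy, ht, h0⟩ := ball_bounds h
    rw [abs_of_nonneg (by positivity)]
    have h1 : (ξ.1 ^ 2 + ξ.2.1 ^ 2) ^ 2 ≤ 1 := pow_le_one₀ (by positivity) h0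
    have h2 : (-ξ.2.2 + 2 * ξ.1 * ξ.2.1) ^ 2 ≤ 2 ^ 2 := by
      rw [sq_le_sq, abs_of_pos (by norm_num : (0:ℝ) < 2)]
      rw [abs_le] at *
      constructor <;> nlinarith [sq_nonneg (ξ.1 - ξ.2.1), sq_nonneg (ξ.1 + ξ.2.1)]
    linarith
  have i4 : Integrable (fun ξ : ℝ × ℝ × ℝ => 1 / koranyi ξ ^ 2 -
      r ^ 2 * ((12 * (ξ.1 ^ 2 + ξ.2.1 ^ 2)) / koranyi ξ ^ 2))
      (volume.restrict (koranyiBall 1)) := Integrable.sub inv_int (i2.const_mul (r ^ 2))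
  rw [← integral_const_mul, ← integral_const_mul, ← integral_sub inv_int (i2.const_mul _),
    ← integral_add i4 (i3.const_mul _)]
  congr 1
  ext ξ
  simp only [gradSq, dil_apply]
  ring

theorem b_pos : 0 < ∫ ξ : ℝ × ℝ × ℝ in koranyiBall 1,
    (12 * (ξ.1 ^ 2 + ξ.2.1 ^ 2)) / koranyi ξ ^ 2 := by
  have i2 : IntegrableOn (fun ξ : ℝ × ℝ × ℝ =>
      (12 * (ξ.1 ^ 2 + ξ.2.1 ^ 2)) / koranyi ξ ^ 2) (koranyiBall 1) := by
    refine mul_inv_int (g := fun ξ => 12 * (ξ.1 ^ 2 + ξ.2.1 ^ 2)) (by fun_prop) 12 ?_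
    intro ξ h
    have := (ball_bounds h).2.2.2
    rw [abs_of_nonneg (by positivity)]
    linarith
  rw [setIntegral_pos_iff_support_of_nonneg_ae
    (Filter.Eventually.of_forall fun ξ => by dsimp; positivity) i2]
  have ho : IsOpen (koranyiBall 1 ∩ {ξ : ℝ × ℝ × ℝ | 0 < ξ.1}) :=
    (ball_open 1).inter (isOpen_lt continuous_const continuous_fst)
  have hne : (koranyiBall 1 ∩ {ξ : ℝ × ℝ × ℝ | 0 < ξ.1}).Nonempty := by
    refine ⟨(1/2, 0, 0), ?_, ?_⟩
    · rw [lt_one_iff]; norm_num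
    · simp
  refine (ho.measure_pos volume hne).trans_le (measure_mono ?_)
  rintro ξ ⟨h, hx⟩
  have hx : 0 < ξ.1 := hx
  refine ⟨?_, h⟩
  have hk : koranyi ξ ≠ 0 := by
    intro h0
    have := kor_pow4 ξ
    rw [h0] at this
    have : 0 < (ξ.1 ^ 2 + ξ.2.1 ^ 2) ^ 2 + ξ.2.2 ^ 2 := by positivity
    linarith
  have : 0 < (12 * (ξ.1 ^ 2 + ξ.2.1 ^ 2)) / koranyi ξ ^ 2 := by
    have := kor_nonneg ξ
    positivity
  exact this.ne'

theorem u_cont : Continuous uFun := by unfold uFun; fun_prop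

theorem u_null : ∀ᵐ ξ : ℝ × ℝ × ℝ, uFun ξ ≠ 0 := by
  have hm : MeasurableSet {ξ : ℝ × ℝ × ℝ | uFun ξ = 0} :=
    (isClosed_eq u_cont continuous_const).measurableSet
  have h : ∀ᵐ x : ℝ, x ≠ 0 := by simp [ae_iff]
  rw [ae_iff]
  simp only [ne_eq, not_not]
  refine (Measure.measure_prod_null hm).2 (Filter.Eventually.of_forall fun x => ?_)
  refine (Measure.measure_prod_null (measurable_prodMk_left hm)).2 ?_
  filter_upwards [h] with y hy
  refine Set.Subsingleton.measure_zero ?_ volume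
  intro s hs t ht
  simp only [uFun, Set.mem_preimage, Set.mem_ofPred_eq] at hs ht
  have : y * (s - t) = 0 := by linarith
  rcases mul_eq_zero.1 this with h | h
  · exact absurd h hy
  · linarith

theorem neg_eq (r : ℝ) :
    (∫ ξ in koranyiBall r ∩ {ξ | uFun ξ < 0}, gradSq ξ / (koranyi ξ) ^ 2) =
    ∫ ξ in koranyiBall r ∩ {ξ | 0 < uFun ξ}, gradSq ξ / (koranyi ξ) ^ 2 := by
  have hk : ∀ ξ, koranyi (dil (-1) ξ) = koranyi ξ := by
    intro ξ; simp [koranyi, dil_apply]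
  have hu : ∀ ξ, uFun (dil (-1) ξ) = - uFun ξ := by
    intro ξ; simp only [uFun, dil_apply]; ring
  have hg : ∀ ξ, gradSq (dil (-1) ξ) = gradSq ξ := by
    intro ξ; simp only [gradSq, dil_apply]; ring
  have hd : ∀ ξ, dil (-1) (dil (-1) ξ) = ξ := by
    intro ξ; simp [dil_apply]
  have him : koranyiBall r ∩ {ξ | uFun ξ < 0} =
      dil (-1) '' (koranyiBall r ∩ {ξ | 0 < uFun ξ}) := by
    ext ξ
    constructor
    · rintro ⟨h1, h2⟩
      refine ⟨dil (-1) ξ, ⟨?_, ?_⟩, hd ξ⟩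
      · change koranyi _ < r
        rw [hk]; exact h1
      · change 0 < uFun _
        rw [hu]; exact neg_pos.2 h2
    · rintro ⟨η, ⟨h1, h2⟩, rfl⟩
      refine ⟨?_, ?_⟩
      · change koranyi _ < r
        rw [hk]; exact h1
      · change uFun _ < 0
        rw [hu]; exact neg_lt_zero.2 h2
  rw [him, integral_image_eq_integral_abs_det_fderiv_smul volume
    ((ball_open r).inter (isOpen_lt continuous_const u_cont)).measurableSet
    (f' := fun _ => dil (-1))
    (fun x _ => (dil (-1)).hasFDerivAt.hasFDerivWithinAt)]
  · congr 1
    ext ξ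
    rw [dil_det, hk, hg]
    norm_num
  · intro a _ b _ h
    rw [← hd a, h, hd]

theorem full_int {r : ℝ} (hr : 0 < r) :
    IntegrableOn (fun ξ => gradSq ξ / koranyi ξ ^ 2) (koranyiBall r) := by
  rw [← dil_image hr, integrableOn_image_iff_integrableOn_abs_det_fderiv_smul volume
    (ball_open 1).measurableSet (f' := fun _ => dil r)
    (fun x _ => (dil r).hasFDerivAt.hasFDerivWithinAt)]
  · have hi : IntegrableOn (fun ξ => gradSq (dil r ξ) / koranyi ξ ^ 2) (koranyiBall 1) := by
      have hc : Continuous (fun ξ => gradSq (dil r ξ)) := by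
        unfold gradSq; fun_prop
      have hcomp : IsCompact (Set.Icc (-1:ℝ) 1 ×ˢ (Set.Icc (-1:ℝ) 1 ×ˢ Set.Icc (-1:ℝ) 1)) :=
        isCompact_Icc.prod (isCompact_Icc.prod isCompact_Icc)
      obtain ⟨C, hC⟩ := hcomp.exists_bound_of_continuousOn hc.continuousOn
      refine mul_inv_int hc C fun ξ h => ?_
      obtain ⟨hx, hy, ht, -⟩ := ball_bounds h
      exact hC ξ ⟨abs_le.1 hx, abs_le.1 hy, abs_le.1 ht⟩
    refine IntegrableOn.congr_fun (hi.const_mul (r ^ 2)) (fun ξ _ => ?_) (ball_open 1).measurableSet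
    rw [dil_det, kor_dil hr, abs_of_pos (by positivity), smul_eq_mul]
    by_cases h : koranyi ξ = 0
    · simp [h]
    · field_simp
  · intro a _ b _ h
    simp only [dil_apply, Prod.mk.injEq, mul_eq_mul_left_iff, hr.ne', pow_ne_zero, or_false,
      ne_eq, OfNat.ofNat_ne_zero, not_false_eq_true] at h
    ext
    · exact h.1
    · exact h.2.1
    · simpa [hr.ne'] using h.2.2

theorem half_int {r : ℝ} (hr : 0 < r) :
    2 * (∫ ξ in koranyiBall r ∩ {ξ | 0 < uFun ξ}, gradSq ξ / (koranyi ξ) ^ 2) =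
    ∫ ξ in koranyiBall r, gradSq ξ / koranyi ξ ^ 2 := by
  have hm : MeasurableSet (koranyiBall r ∩ {ξ | uFun ξ < 0}) :=
    ((ball_open r).inter (isOpen_lt u_cont continuous_const)).measurableSet
  have hi := full_int hr
  rw [two_mul]
  nth_rewrite 2 [← neg_eq r]
  rw [← setIntegral_union _ hm (hi.mono_set Set.inter_subset_left)
    (hi.mono_set Set.inter_subset_left)]
  · apply setIntegral_congr_set
    filter_upwards [u_null] with ξ h
    apply propext
    constructor
    · rintro (h | h)
      · exact h.1
      · exact h.1
    · intro hb
      rcases lt_or_gt_of_ne h with h | h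
      · exact Or.inr ⟨hb, h⟩
      · exact Or.inl ⟨hb, h⟩
  · rw [Set.disjoint_left]
    rintro ξ ⟨-, h⟩ ⟨-, h'⟩
    exact lt_asymm (show 0 < uFun ξ from h) (show uFun ξ < 0 from h')

theorem J_eq {r : ℝ} (hr : 0 < r) : Jfun r =
    (∫ ξ in koranyiBall 1, gradSq (dil r ξ) / koranyi ξ ^ 2) ^ 2 / 4 := by
  unfold Jfun
  rw [neg_eq]
  have h := half_int hr
  rw [int_scale hr, integral_const_mul] at h
  have h' : (∫ ξ in koranyiBall r ∩ {ξ | 0 < uFun ξ}, gradSq ξ / (koranyi ξ) ^ 2) =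
    r ^ 2 * (∫ ξ in koranyiBall 1, gradSq (dil r ξ) / koranyi ξ ^ 2) / 2 := by linarith
  rw [h']
  field_simp
  norm_num

/-- No Alt–Caffarelli–Friedman type increasing monotonicity formula holds in ℍ¹:
    for u = x − 3yt − 2x³, J is strictly monotone decreasing near r = 0. -/
theorem Jfun_strictly_decreasing :
    ∃ ε : ℝ, 0 < ε ∧ StrictAntiOn Jfun (Set.Ioo 0 ε) := by
  have hb := b_pos
  have hs := @scaled_int
  have hc : 0 ≤ ∫ ξ : ℝ × ℝ × ℝ in koranyiBall 1, (36 * (ξ.1 ^ 2 + ξ.2.1 ^ 2) ^ 2 +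
        9 * (-ξ.2.2 + 2 * ξ.1 * ξ.2.1) ^ 2) / koranyi ξ ^ 2 :=
    integral_nonneg fun ξ => by dsimp; positivity
  have hF : ∀ r : ℝ, 0 ≤ ∫ ξ in koranyiBall 1, gradSq (dil r ξ) / koranyi ξ ^ 2 := fun r =>
    integral_nonneg fun ξ => by dsimp [gradSq]; positivity
  generalize (∫ ξ in koranyiBall 1, 1 / koranyi ξ ^ 2) = a at *
  generalize (∫ ξ : ℝ × ℝ × ℝ in koranyiBall 1,
    (12 * (ξ.1 ^ 2 + ξ.2.1 ^ 2)) / koranyi ξ ^ 2) = b at *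
  generalize (∫ ξ : ℝ × ℝ × ℝ in koranyiBall 1, (36 * (ξ.1 ^ 2 + ξ.2.1 ^ 2) ^ 2 +
        9 * (-ξ.2.2 + 2 * ξ.1 * ξ.2.1) ^ 2) / koranyi ξ ^ 2) = c at *
  refine ⟨min 1 (b / (2 * (c + 1))), by positivity, ?_⟩
  rintro r ⟨hr0, hr⟩ s ⟨hs0, hs'⟩ hrs
  obtain ⟨hs1, hs2⟩ := lt_min_iff.1 hs'
  rw [J_eq hr0, J_eq hs0]
  have key : (∫ ξ in koranyiBall 1, gradSq (dil s ξ) / koranyi ξ ^ 2) <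
      ∫ ξ in koranyiBall 1, gradSq (dil r ξ) / koranyi ξ ^ 2 := by
    rw [hs, hs]
    rw [lt_div_iff₀ (by positivity)] at hs2
    have h1 : r ^ 2 < s ^ 2 := by gcongr
    have h2 : s ^ 2 ≤ s := by nlinarith
    have h3 : c * (r ^ 2 + s ^ 2) ≤ c * (2 * s) := by gcongr; linarith
    have h4 : 0 < (s ^ 2 - r ^ 2) * (b - c * (r ^ 2 + s ^ 2)) := by
      apply mul_pos <;> nlinarith
    nlinarith
  have := pow_lt_pow_left₀ key (hF s) (n := 2) (by norm_num)
  linarith
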